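/- For J ⊆ {1,2,3,4} let F_J = {[J], [J∪{5}], [J∪{6}], [J∪{5,6}]} ⊆ Λ̃ (note F_J = F_{{1,2,3,4}∖J}), and let 𝒮 = {F_J : J ⊆ {1,2,3,4}, |J| even}, a collection of four pairwise disjoint 4-element subsets of Λ̃. Let H be the group of those adjacency-preserving permutations g of Λ̃ such that g(F) ∈ 𝒮 for every F ∈ 𝒮. Then H has order 768, the natural homomorphism from H to the symmetric group on the four-element set 𝒮 is surjective, and its kernel (the group of adjacency-preserving permutations fixing each member of 𝒮 setwise) has order 32. -/

import Mathlib

/-- The relation on subsets of `{1,…,6}` identifying a subset with its complement. -/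
def lamRel (I J : Finset (Fin 6)) : Prop := J = I ∨ J = Iᶜ

instance : DecidableRel lamRel := fun I J => inferInstanceAs (Decidable (J = I ∨ J = Iᶜ))

/-- `lamRel` is an equivalence relation. -/
def lamSetoid : Setoid (Finset (Fin 6)) where
  r := lamRel
  iseqv := by
    constructor
    · intro I; left; rfl
    · rintro I J (rfl | rfl)
      · left; rfl
      · right; rw [compl_compl]
    · rintro I J K (rfl | rfl) h <;> rcases h with (rfl | rfl) <;>
        simp [lamRel, compl_compl]

/-- The 32-element set `Λ̃` of classes of subsets of `{1,…,6}` modulo complementation. -/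
def Lam : Type := Quotient lamSetoid

/-- Two classes are adjacent if (for representatives) the symmetric difference has
cardinality `1` or `5`; this condition is independent of the choice of representatives. -/
def lamAdj (a b : Lam) : Prop :=
  ∃ I J : Finset (Fin 6), a = Quotient.mk lamSetoid I ∧ b = Quotient.mk lamSetoid J ∧
    ((symmDiff I J).card = 1 ∨ (symmDiff I J).card = 5)

/-- For `J ⊆ {1,2,3,4}` (indices `0,1,2,3` of `Fin 6`), the 4-gon
`F_J = {[J], [J∪{5}], [J∪{6}], [J∪{5,6}]}` (indices `4,5` playing the role of `5,6`). -/
def FJ (J : Finset (Fin 6)) : Set Lam :=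
  {Quotient.mk lamSetoid J, Quotient.mk lamSetoid (J ∪ {4}),
   Quotient.mk lamSetoid (J ∪ {5}), Quotient.mk lamSetoid (J ∪ {4, 5})}

/-- The \gonquad `𝒮 = {F_J : J ⊆ {1,2,3,4}, |J| even}`. -/
def Scal : Set (Set Lam) :=
  {S | ∃ J : Finset (Fin 6), J ⊆ ({0, 1, 2, 3} : Finset (Fin 6)) ∧ Even J.card ∧ S = FJ J}

namespace S10

/-- Bit-vector model: adjacency on `Fin 32`. -/
def adj (x y : Fin 32) : Bool :=
  match x.val ^^^ y.val with
  | 1 => true | 2 => true | 4 => true | 8 => true | 16 => true | 31 => true | _ => false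

/-- Index of the block containing `x` (4 for points outside of the blocks). -/
def c (x : Fin 32) : ℕ :=
  match x.val % 16 with
  | 0 => 0 | 15 => 0 | 3 => 1 | 12 => 1 | 5 => 2 | 10 => 2 | 6 => 3 | 9 => 3 | _ => 4

def pw (i : Fin 4) : Fin 32 :=
  match i with
  | 0 => 1 | 1 => 2 | 2 => 4 | 3 => 8

def g6 (i : Fin 6) : Fin 32 :=
  match i with
  | 0 => 1 | 1 => 2 | 2 => 4 | 3 => 8 | 4 => 16 | 5 => 31

def lin (s : Fin 4 → Fin 4) (b : Bool) (x : Fin 32) : Fin 32 :=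
  (bif x.val.testBit 0 then pw (s 0) else 0) ^^^ (bif x.val.testBit 1 then pw (s 1) else 0) ^^^
  (bif x.val.testBit 2 then pw (s 2) else 0) ^^^ (bif x.val.testBit 3 then pw (s 3) else 0) ^^^
  (bif x.val.testBit 4 then (bif b then 31 else 16) else 0)

/-- Encoding of a subset. -/
def enc (I : Finset (Fin 6)) : Fin 32 :=
  (bif decide (0 ∈ I) then 1 else 0) ^^^ (bif decide (1 ∈ I) then 2 else 0) ^^^
  (bif decide (2 ∈ I) then 4 else 0) ^^^ (bif decide (3 ∈ I) then 8 else 0) ^^^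
  (bif decide (4 ∈ I) then 16 else 0) ^^^ (bif decide (5 ∈ I) then 31 else 0)

def rep (x : Fin 32) : Finset (Fin 6) :=
  Finset.univ.filter (fun i => x.val.testBit i.val = true)

theorem enc_compl : ∀ I : Finset (Fin 6), enc Iᶜ = enc I := by decide +kernel
theorem enc_rep : ∀ x, enc (rep x) = x := by decide +kernel
theorem rep_enc : ∀ I, I = rep (enc I) ∨ I = (rep (enc I))ᶜ := by decide +kernel
theorem adj_of_card : ∀ I J : Finset (Fin 6), ((symmDiff I J).card = 1 ∨ (symmDiff I J).card = 5) →
    adj (enc I) (enc J) = true := by decide +kernel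
theorem card_of_adj : ∀ x y : Fin 32, adj x y = true →
   ((symmDiff (rep x) (rep y)).card = 1 ∨ (symmDiff (rep x) (rep y)).card = 5) := by decide +kernel

def e : Lam ≃ Fin 32 where
  toFun := Quotient.lift enc (by
    rintro I J (rfl | rfl)
    · rfl
    · rw [enc_compl])
  invFun x := Quotient.mk lamSetoid (rep x)
  left_inv := by
    intro a
    induction a using Quotient.inductionOn with
    | h I => exact Quotient.sound (rep_enc I)
  right_inv := enc_rep

theorem e_mk (I) : e (Quotient.mk lamSetoid I) = enc I := rfl

theorem lamAdj_iff (a b : Lam) : lamAdj a b ↔ adj (e a) (e b) = true := by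
  constructor
  · rintro ⟨I, J, rfl, rfl, h⟩
    exact adj_of_card I J h
  · intro h
    exact ⟨rep (e a), rep (e b), (e.left_inv a).symm, (e.left_inv b).symm, card_of_adj _ _ h⟩

def B (j : Fin 4) : Set Lam := {a | c (e a) = j.val}

theorem mem_FJ (J) (a : Lam) : a ∈ FJ J ↔ (e a = enc J ∨ e a = enc (J ∪ {4}) ∨
    e a = enc (J ∪ {5}) ∨ e a = enc (J ∪ {4,5})) := by
  have h : ∀ I, e a = enc I ↔ a = (Quotient.mk lamSetoid I : Lam) := fun I =>
    e.apply_eq_iff_eq (x := a) (y := (Quotient.mk lamSetoid I : Lam))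
  rw [h, h, h, h]
  exact Iff.rfl

theorem FJ_B : ∀ J : Finset (Fin 6), J ⊆ ({0, 1, 2, 3} : Finset (Fin 6)) → J.card % 2 = 0 →
    ∃ j : Fin 4, ∀ x : Fin 32, (x = enc J ∨ x = enc (J ∪ {4}) ∨
    x = enc (J ∪ {5}) ∨ x = enc (J ∪ {4,5})) ↔ c x = j.val := by decide +kernel
theorem B_FJ : ∀ j : Fin 4, ∃ J : Finset (Fin 6), J ⊆ ({0, 1, 2, 3} : Finset (Fin 6)) ∧
    J.card % 2 = 0 ∧ ∀ x : Fin 32, (x = enc J ∨ x = enc (J ∪ {4}) ∨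
    x = enc (J ∪ {5}) ∨ x = enc (J ∪ {4,5})) ↔ c x = j.val := by decide +kernel

theorem mem_Scal (S : Set Lam) : S ∈ Scal ↔ ∃ j, S = B j := by
  constructor
  · rintro ⟨J, h1, h2, rfl⟩
    obtain ⟨j, hj⟩ := FJ_B J h1 (Nat.even_iff.1 h2)
    exact ⟨j, Set.ext fun a => (mem_FJ J a).trans (hj (e a))⟩
  · rintro ⟨j, rfl⟩
    obtain ⟨J, h1, h2, hj⟩ := B_FJ j
    exact ⟨J, h1, Nat.even_iff.2 h2, Set.ext fun a => ((mem_FJ J a).trans (hj (e a))).symm⟩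

def br (j : Fin 4) : Fin 32 :=
  match j with
  | 0 => 0 | 1 => 3 | 2 => 5 | 3 => 6

theorem c_br : ∀ j, c (br j) = j.val := by decide

theorem image_B (g : Equiv.Perm Lam) (j k : Fin 4) : g '' B j = B k ↔
    ∀ x, c x = j.val ↔ c (e.permCongr g x) = k.val := by
  rw [Set.ext_iff]
  constructor
  · intro h x
    have := h (g (e.symm x))
    simpa [B] using this
  · intro h a
    have := h (e (g.symm a))
    simpa [B, Equiv.image_eq_preimage_symm] using this

theorem B_inj : Function.Injective B := by
  intro j k h
  have : e.symm (br j) ∈ B k := by rw [← h]; simp [B, c_br]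
  simp [B, c_br] at this
  exact Fin.ext this

abbrev Aut (f : Equiv.Perm (Fin 32)) : Prop := ∀ x y, adj (f x) (f y) = adj x y
abbrev Stab (f : Equiv.Perm (Fin 32)) : Prop :=
  ∀ j : Fin 4, ∃ k : Fin 4, ∀ x, c x = j.val ↔ c (f x) = k.val
abbrev Fix (f : Equiv.Perm (Fin 32)) : Prop :=
  ∀ j : Fin 4, ∀ x, c x = j.val ↔ c (f x) = j.val

theorem aut_iff (g : Equiv.Perm Lam) :
    (∀ a b : Lam, lamAdj (g a) (g b) ↔ lamAdj a b) ↔ Aut (e.permCongr g) := by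
  constructor
  · intro h x y
    have := h (e.symm x) (e.symm y)
    rw [lamAdj_iff, lamAdj_iff, e.apply_symm_apply, e.apply_symm_apply] at this
    exact Bool.eq_iff_iff.2 this
  · intro h a b
    rw [lamAdj_iff, lamAdj_iff]
    have := h (e a) (e b)
    simp only [Equiv.permCongr_apply, Equiv.symm_apply_apply] at this
    rw [this]

theorem stab_iff (g : Equiv.Perm Lam) :
    (∀ S ∈ Scal, (⇑g '' S) ∈ Scal) ↔ Stab (e.permCongr g) := by
  simp only [mem_Scal, forall_exists_index, forall_eq_apply_imp_iff, image_B]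

theorem fix_iff (g : Equiv.Perm Lam) :
    (∀ S ∈ Scal, (⇑g '' S) = S) ↔ Fix (e.permCongr g) := by
  simp only [mem_Scal, forall_exists_index, forall_eq_apply_imp_iff, image_B]

/-! The explicit elements of the group. -/

theorem xor_invol : ∀ t x : Fin 32, t ^^^ (t ^^^ x) = x := by decide +kernel
theorem xor_val : ∀ x y : Fin 32, (x ^^^ y).val = x.val ^^^ y.val := by decide +kernel
theorem xor_adj (t x y : Fin 32) : adj (t ^^^ x) (t ^^^ y) = adj x y := by
  have : (t ^^^ x).val ^^^ (t ^^^ y).val = x.val ^^^ y.val := by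
    rw [xor_val, xor_val, Nat.xor_comm t.val x.val, Nat.xor_assoc, ← Nat.xor_assoc t.val t.val,
      Nat.xor_self, Nat.zero_xor]
  simp only [adj, this]
theorem adj_gen : ∀ x y : Fin 32, adj x y = true → ∃ i, y = x ^^^ g6 i := by decide +kernel
theorem lin_inv : ∀ (s : Equiv.Perm (Fin 4)) (b : Bool) (x : Fin 32),
   lin s.symm b (lin s b x) = x := by decide +kernel
theorem lin_adj_gen : ∀ (s : Equiv.Perm (Fin 4)) (b : Bool) (x : Fin 32) (i : Fin 6),
   adj (lin s b x) (lin s b (x ^^^ g6 i)) = true := by decide +kernel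
theorem lin_adj_of (s : Equiv.Perm (Fin 4)) (b : Bool) (x y : Fin 32) (h : adj x y = true) :
    adj (lin s b x) (lin s b y) = true := by
  obtain ⟨i, rfl⟩ := adj_gen x y h
  exact lin_adj_gen s b x i
theorem lin_adj (s : Equiv.Perm (Fin 4)) (b : Bool) (x y : Fin 32) :
    adj (lin s b x) (lin s b y) = adj x y := by
  refine Bool.eq_iff_iff.2 ⟨fun h => ?_, lin_adj_of s b x y⟩
  have := lin_adj_of s.symm b _ _ h
  rwa [lin_inv, lin_inv] at this

abbrev T := {t : Fin 32 // c t < 4}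
abbrev P := T × Equiv.Perm (Fin 4) × Bool

def fn (p : P) (x : Fin 32) : Fin 32 := p.1.val ^^^ lin p.2.1 p.2.2 x

theorem xor_c : ∀ t : Fin 32, c t < 4 → ∀ z, c z < 4 →
    c (t ^^^ z) < 4 ∧ ∀ y, c y = c z ↔ c (t ^^^ y) = c (t ^^^ z) := by decide +kernel
theorem lin_c : ∀ (s : Equiv.Perm (Fin 4)) (b : Bool) (j : Fin 4), c (lin s b (br j)) < 4 ∧
    ∀ x, c x = j.val ↔ c (lin s b x) = c (lin s b (br j)) := by decide +kernel

theorem fn_stab (p : P) (j : Fin 4) (x) : c x = j.val ↔ c (fn p x) = c (fn p (br j)) :=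
  ((lin_c p.2.1 p.2.2 j).2 x).trans ((xor_c _ p.1.2 _ (lin_c p.2.1 p.2.2 j).1).2 _)
theorem fn_lt (p : P) (j : Fin 4) : c (fn p (br j)) < 4 :=
  (xor_c _ p.1.2 _ (lin_c p.2.1 p.2.2 j).1).1

def A (p : P) : Equiv.Perm (Fin 32) where
  toFun := fn p
  invFun y := lin p.2.1.symm p.2.2 (p.1.val ^^^ y)
  left_inv x := by simp only [fn, xor_invol, lin_inv]
  right_inv y := by
    have := lin_inv p.2.1.symm p.2.2 (p.1.val ^^^ y)
    simp only [Equiv.symm_symm] at this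
    simp only [fn, this, xor_invol]

theorem A_aut (p) : Aut (A p) := fun x y => by
  change adj (fn p x) (fn p y) = _
  simp only [fn, xor_adj, lin_adj]

theorem A_stab (p) : Stab (A p) := fun j => ⟨⟨_, fn_lt p j⟩, fn_stab p j⟩

theorem lin_zero (s b) : lin s b 0 = 0 := by simp [lin]
theorem lin_pw : ∀ (s : Equiv.Perm (Fin 4)) (b : Bool) i, lin s b (pw i) = pw (s i) := by
  decide +kernel
theorem lin_16 : ∀ (s : Equiv.Perm (Fin 4)) (b : Bool), lin s b 16 = bif b then 31 else 16 := by
  decide +kernel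
theorem lin_31 : ∀ (s : Equiv.Perm (Fin 4)) (b : Bool), lin s b 31 = bif b then 16 else 31 := by
  decide +kernel
theorem xor_zero : ∀ t : Fin 32, t ^^^ 0 = t := by decide
theorem pw_inj : Function.Injective pw := by unfold Function.Injective; decide

theorem xor_cancel {t x y : Fin 32} (h : t ^^^ x = t ^^^ y) : x = y := by
  rw [← xor_invol t x, h, xor_invol]

theorem A_inj : Function.Injective A := by
  rintro ⟨t, s, b⟩ ⟨t', s', b'⟩ h
  have hf : ∀ x, fn (t, s, b) x = fn (t', s', b') x := fun x => congrArg (fun f => f x) h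
  simp only [fn] at hf
  have ht : t = t' := by
    have := hf 0
    rw [lin_zero, lin_zero, xor_zero, xor_zero] at this
    exact Subtype.ext this
  subst ht
  have hl : ∀ x, lin s b x = lin s' b' x := fun x => xor_cancel (hf x)
  have hs : s = s' := by
    ext1 i
    have := hl (pw i)
    rw [lin_pw, lin_pw] at this
    exact pw_inj this
  have hb : b = b' := by
    have := hl 16
    rw [lin_16, lin_16] at this
    clear hf hl h
    revert this; revert b b'; decide
  rw [hs, hb]

/-! Rigidity. -/

theorem fix_step {f : Equiv.Perm (Fin 32)} (hf : Aut f) {x a b d : Fin 32}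
    (ha : f a = a) (hb : f b = b) (hd : f d = d) (hxa : adj x a = true) (hxb : adj x b = true)
    (hxd : x ≠ d) (h : ∀ y, adj y a = true → adj y b = true → y = d ∨ y = x) : f x = x := by
  have h1 := hf x a
  have h2 := hf x b
  rw [ha, hxa] at h1
  rw [hb, hxb] at h2
  rcases h _ h1 h2 with h | h
  · exact absurd (f.injective (h.trans hd.symm)) hxd
  · exact h

theorem step2 : ∀ i j : Fin 6, i ≠ j → adj (g6 i ^^^ g6 j) (g6 i) = true ∧
    adj (g6 i ^^^ g6 j) (g6 j) = true ∧ g6 i ^^^ g6 j ≠ 0 ∧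
    ∀ y, adj y (g6 i) = true → adj y (g6 j) = true → y = 0 ∨ y = g6 i ^^^ g6 j := by
  decide +kernel

theorem step3 : ∀ i j k : Fin 6, i ≠ j → i ≠ k → j ≠ k →
    adj (g6 i ^^^ g6 j ^^^ g6 k) (g6 i ^^^ g6 j) = true ∧
    adj (g6 i ^^^ g6 j ^^^ g6 k) (g6 i ^^^ g6 k) = true ∧ g6 i ^^^ g6 j ^^^ g6 k ≠ g6 i ∧
    ∀ y, adj y (g6 i ^^^ g6 j) = true → adj y (g6 i ^^^ g6 k) = true →
      y = g6 i ∨ y = g6 i ^^^ g6 j ^^^ g6 k := by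
  decide +kernel

theorem cover : ∀ x : Fin 32, x = 0 ∨ (∃ i, x = g6 i) ∨ (∃ i j, i ≠ j ∧ x = g6 i ^^^ g6 j) ∨
    ∃ i j k, i ≠ j ∧ i ≠ k ∧ j ≠ k ∧ x = g6 i ^^^ g6 j ^^^ g6 k := by decide +kernel

theorem rigid {f : Equiv.Perm (Fin 32)} (hf : Aut f) (h0 : f 0 = 0) (hg : ∀ i, f (g6 i) = g6 i)
    (x) : f x = x := by
  have h2 : ∀ i j, i ≠ j → f (g6 i ^^^ g6 j) = g6 i ^^^ g6 j := by
    intro i j hij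
    obtain ⟨a1, a2, a3, a4⟩ := step2 i j hij
    exact fix_step hf (hg i) (hg j) h0 a1 a2 a3 a4
  rcases cover x with rfl | ⟨i, rfl⟩ | ⟨i, j, hij, rfl⟩ | ⟨i, j, k, hij, hik, hjk, rfl⟩
  · exact h0
  · exact hg i
  · exact h2 i j hij
  · obtain ⟨a1, a2, a3, a4⟩ := step3 i j k hij hik hjk
    exact fix_step hf (h2 i j hij) (h2 i k hik) (hg i) a1 a2 a3 a4

theorem rigid2 {f h : Equiv.Perm (Fin 32)} (hf : Aut f) (hh : Aut h) (h0 : f 0 = h 0)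
    (hg : ∀ i, f (g6 i) = h (g6 i)) : f = h := by
  have key := rigid (f := f.trans h.symm)
    (fun x y => by
      have := hh (h.symm (f x)) (h.symm (f y))
      simp only [Equiv.apply_symm_apply] at this
      simp only [Equiv.trans_apply, ← this, hf])
    (by simp [h0]) (by intro i; simp [hg])
  ext1 x
  have := key x
  simp only [Equiv.trans_apply, Equiv.symm_apply_eq] at this
  exact this

theorem F1 : ∀ t y : Fin 32, adj t y = true → c y = c t → c t < 4 →
    y = t ^^^ 16 ∨ y = t ^^^ 31 := by decide +kernel
theorem F2 : ∀ t y : Fin 32, adj t y = true → c y ≠ c t → ∃ i, y = t ^^^ pw i := by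
  decide +kernel

theorem A_surj {f : Equiv.Perm (Fin 32)} (hf : Aut f) (hs : Stab f) : ∃ p, A p = f := by
  obtain ⟨k, hk⟩ := hs 0
  have ht : c (f 0) = k.val := (hk 0).1 (by decide)
  have h16 : c (f 16) = c (f 0) := ht ▸ (hk 16).1 (by decide)
  have h31 : c (f 31) = c (f 0) := ht ▸ (hk 31).1 (by decide)
  have hlt : c (f 0) < 4 := ht ▸ k.2
  have hpw : ∀ i, ∃ j, f (pw i) = f 0 ^^^ pw j := by
    intro i
    refine F2 _ _ ?_ ?_
    · rw [hf]; revert i; decide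
    · rw [ht, Ne, ← hk]; revert i; decide
  choose s hs using hpw
  have hsi : Function.Injective s := by
    intro i j hij
    apply pw_inj
    apply f.injective
    rw [hs, hs, hij]
  have e16 := F1 _ _ (by rw [hf]; decide) h16 hlt
  have e31 := F1 _ _ (by rw [hf]; decide) h31 hlt
  have hne : f 16 ≠ f 31 := fun h => absurd (f.injective h) (by decide)
  have hb : ∃ b : Bool, f 16 = f 0 ^^^ (bif b then 31 else 16) ∧
      f 31 = f 0 ^^^ (bif b then 16 else 31) := by
    rcases e16 with a | a <;> rcases e31 with b | b
    · exact absurd (a.trans b.symm) hne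
    · exact ⟨false, a, b⟩
    · exact ⟨true, a, b⟩
    · exact absurd (a.trans b.symm) hne
  obtain ⟨b, hb1, hb2⟩ := hb
  let p : P := (⟨f 0, hlt⟩, Equiv.ofBijective s (Finite.injective_iff_bijective.1 hsi), b)
  have hA : ∀ x, A p x = f 0 ^^^ lin p.2.1 b x := fun x => rfl
  have hAp : ∀ i, A p (pw i) = f (pw i) := by
    intro i
    rw [hA, lin_pw, hs]; rfl
  refine ⟨p, rigid2 (A_aut p) hf ?_ ?_⟩
  · rw [hA, lin_zero, xor_zero]
  · intro i
    fin_cases i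
    · exact hAp 0
    · exact hAp 1
    · exact hAp 2
    · exact hAp 3
    · exact (hA 16).trans (by rw [lin_16]; exact hb1.symm)
    · exact (hA 31).trans (by rw [lin_31]; exact hb2.symm)

theorem fix_stab {f} (h : Fix f) : Stab f := fun j => ⟨j, h j⟩

def fixB (p : P) : Bool := decide (∀ j : Fin 4, c (fn p (br j)) = j.val)

theorem fix_A (p : P) : Fix (A p) ↔ fixB p = true := by
  simp only [fixB, decide_eq_true_eq]
  constructor
  · intro h j
    exact (h j (br j)).1 (c_br j)
  · intro h j x
    have := fn_stab p j x
    rw [h j] at this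
    exact this

theorem cardP : Fintype.card P = 768 := by
  have : Fintype.card T = 16 := by decide +kernel
  simp [P, Fintype.card_prod, this, Fintype.card_perm, Nat.factorial]

theorem cardK : Fintype.card {p : P // fixB p = true} = 32 := by decide +kernel

theorem surjP : ∀ s : Equiv.Perm (Fin 4), ∃ p : P, ∀ j, c (fn p (br j)) = (s j).val := by
  decide +kernel

theorem count1 : Nat.card {f : Equiv.Perm (Fin 32) // Aut f ∧ Stab f} = 768 := by
  refine Eq.trans (Nat.card_congr (Equiv.ofBijective (fun p : P => ⟨A p, A_aut p, A_stab p⟩) ⟨?_, ?_⟩)).symm (Nat.card_eq_fintype_card.trans cardP)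
  · intro p q h
    exact A_inj (congrArg Subtype.val h)
  · rintro ⟨f, h1, h2⟩
    obtain ⟨p, rfl⟩ := A_surj h1 h2
    exact ⟨p, rfl⟩

theorem count2 : Nat.card {f : Equiv.Perm (Fin 32) // Aut f ∧ Fix f} = 32 := by
  refine Eq.trans (Nat.card_congr (Equiv.ofBijective (fun p : {p : P // fixB p = true} =>
    ⟨A p.1, A_aut p.1, (fix_A p.1).2 p.2⟩) ⟨?_, ?_⟩)).symm (Nat.card_eq_fintype_card.trans cardK)
  · intro p q h
    exact Subtype.ext (A_inj (congrArg Subtype.val h))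
  · rintro ⟨f, h1, h2⟩
    obtain ⟨p, rfl⟩ := A_surj h1 (fix_stab h2)
    exact ⟨⟨p, (fix_A p).1 h2⟩, rfl⟩

noncomputable def eB : Fin 4 ≃ ↥Scal :=
  Equiv.ofBijective (fun j => ⟨B j, (mem_Scal _).2 ⟨j, rfl⟩⟩)
    ⟨fun _ _ h => B_inj (congrArg Subtype.val h), fun ⟨S, hS⟩ => by
      obtain ⟨j, rfl⟩ := (mem_Scal S).1 hS
      exact ⟨j, rfl⟩⟩

theorem eB_val (j) : ((eB j : ↥Scal) : Set Lam) = B j := rfl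

end S10

/-- The group `H` of adjacency-preserving permutations of `Λ̃` that permute
the members of `𝒮` has order `768`; the natural homomorphism `H → Sym(𝒮)` is surjective; and
its kernel (adjacency-preserving permutations fixing each member of `𝒮` setwise) has order
`32`. -/
theorem statement10 :
    Nat.card {g : Equiv.Perm Lam //
        (∀ a b : Lam, lamAdj (g a) (g b) ↔ lamAdj a b) ∧ ∀ S ∈ Scal, (⇑g '' S) ∈ Scal}
      = 768 ∧
    (∀ π : Equiv.Perm ↥Scal, ∃ g : Equiv.Perm Lam,
        (∀ a b : Lam, lamAdj (g a) (g b) ↔ lamAdj a b) ∧ (∀ S ∈ Scal, (⇑g '' S) ∈ Scal) ∧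
        ∀ S : ↥Scal, ⇑g '' (S : Set Lam) = ((π S : ↥Scal) : Set Lam)) ∧
    Nat.card {g : Equiv.Perm Lam //
        (∀ a b : Lam, lamAdj (g a) (g b) ↔ lamAdj a b) ∧ ∀ S ∈ Scal, ⇑g '' S = S}
      = 32 := by
  refine ⟨?_, ?_, ?_⟩
  · refine Eq.trans (Nat.card_congr ?_) S10.count1
    exact (S10.e.permCongr.subtypeEquiv fun g =>
      and_congr (S10.aut_iff g) (S10.stab_iff g))
  · intro π
    obtain ⟨p, hp⟩ := S10.surjP ((S10.eB.trans π).trans S10.eB.symm)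
    obtain ⟨g, hg⟩ := S10.e.permCongr.surjective (S10.A p)
    refine ⟨g, (S10.aut_iff g).2 (hg ▸ S10.A_aut p), (S10.stab_iff g).2 (hg ▸ S10.A_stab p), ?_⟩
    intro S
    obtain ⟨j, rfl⟩ := S10.eB.surjective S
    have hk : π (S10.eB j) = S10.eB (((S10.eB.trans π).trans S10.eB.symm) j) := by simp
    rw [hk, S10.eB_val, S10.eB_val, S10.image_B, hg]
    intro x
    rw [← hp j]
    exact S10.fn_stab p j x
  · refine Eq.trans (Nat.card_congr ?_) S10.count2
    exact (S10.e.permCongr.subtypeEquiv fun g =>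
      and_congr (S10.aut_iff g) (S10.fix_iff g))
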